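/- Let L be a meet semidistributive lattice and let (L,x,y,z) be an SD_n(∧)-failure, i.e. x ∧ y_n < x ∧ (y ∨ z). Then for every k with 1 ≤ k ≤ n, either x_k < x ∧ y_k or x_k < x ∧ z_k (that is, either the pentagon Y_k or the pentagon Z_k is nondegenerate). -/

import Mathlib

/-- The pair of sequences `(y_n, z_n)` with `y_0 = y`, `z_0 = z`,
`y_{n+1} = y ⊔ (x ⊓ z_n)`, `z_{n+1} = z ⊔ (x ⊓ y_n)`. -/
def yzSeq {α : Type*} [Lattice α] (x y z : α) : ℕ → α × α
  | 0 => (y, z)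
  | n + 1 => (y ⊔ (x ⊓ (yzSeq x y z n).2), z ⊔ (x ⊓ (yzSeq x y z n).1))

/-- The sequence `y_n`. -/
def ySeq {α : Type*} [Lattice α] (x y z : α) (n : ℕ) : α := (yzSeq x y z n).1

/-- The sequence `z_n`. -/
def zSeq {α : Type*} [Lattice α] (x y z : α) (n : ℕ) : α := (yzSeq x y z n).2

/-- For `k ≥ 1`, `x_k = (x ⊓ y_{k-1}) ⊔ (x ⊓ z_{k-1})`. -/
def xSeq {α : Type*} [Lattice α] (x y z : α) (k : ℕ) : α :=
  (x ⊓ ySeq x y z (k - 1)) ⊔ (x ⊓ zSeq x y z (k - 1))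

theorem yzSeq_monotone {α : Type*} [Lattice α] (x y z : α) : Monotone (yzSeq x y z) := by
  refine monotone_nat_of_le_succ fun n => ?_
  induction n with
  | zero => exact ⟨le_sup_left, le_sup_left⟩
  | succ n ih =>
    exact ⟨sup_le_sup_left (inf_le_inf_left x ih.2) y, sup_le_sup_left (inf_le_inf_left x ih.1) z⟩

theorem ySeq_monotone {α : Type*} [Lattice α] (x y z : α) : Monotone (ySeq x y z) :=
  fun _ _ h => (yzSeq_monotone x y z h).1

theorem zSeq_monotone {α : Type*} [Lattice α] (x y z : α) : Monotone (zSeq x y z) :=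
  fun _ _ h => (yzSeq_monotone x y z h).2

theorem xSeq_succ_le_inf_ySeq {α : Type*} [Lattice α] (x y z : α) (k : ℕ) :
    xSeq x y z (k + 1) ≤ x ⊓ ySeq x y z (k + 1) :=
  sup_le (inf_le_inf_left x (ySeq_monotone x y z k.le_succ)) (le_inf inf_le_left le_sup_right)

theorem xSeq_succ_le_inf_zSeq {α : Type*} [Lattice α] (x y z : α) (k : ℕ) :
    xSeq x y z (k + 1) ≤ x ⊓ zSeq x y z (k + 1) :=
  sup_le (le_inf inf_le_left le_sup_right) (inf_le_inf_left x (zSeq_monotone x y z k.le_succ))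

/-- In a meet semidistributive lattice, if `(L,x,y,z)` is an
`SD_n(∧)`-failure, then for every `1 ≤ k ≤ n` either `Y_k` or `Z_k` is
nondegenerate: `x_k < x ⊓ y_k` or `x_k < x ⊓ z_k`. -/
theorem failure_pentagons_nondegenerate {α : Type*} [Lattice α]
    (hsd : ∀ a b c : α, a ⊓ b = a ⊓ c → a ⊓ b = a ⊓ (b ⊔ c))
    (x y z : α) (n : ℕ) (hfail : x ⊓ ySeq x y z n < x ⊓ (y ⊔ z)) :
    ∀ k : ℕ, 1 ≤ k → k ≤ n →
      xSeq x y z k < x ⊓ ySeq x y z k ∨ xSeq x y z k < x ⊓ zSeq x y z k := by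
  intro k hk hkn
  obtain ⟨k, rfl⟩ := Nat.exists_eq_add_of_le' hk
  by_contra! h
  have hy := (xSeq_succ_le_inf_ySeq x y z k).eq_of_not_lt h.1
  have hz := (xSeq_succ_le_inf_zSeq x y z k).eq_of_not_lt h.2
  refine hfail.not_ge ?_
  calc x ⊓ (y ⊔ z) ≤ x ⊓ (ySeq x y z (k + 1) ⊔ zSeq x y z (k + 1)) :=
        inf_le_inf_left x (sup_le_sup le_sup_left le_sup_left)
    _ = x ⊓ ySeq x y z (k + 1) := (hsd _ _ _ (hy.symm.trans hz)).symm
    _ ≤ x ⊓ ySeq x y z n := inf_le_inf_left x (ySeq_monotone x y z hkn)
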